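/- Let n ≥ 1, c > 0, let g be a constant symmetric invertible (n+1)×(n+1) real matrix with inverse entries g^{μν}, let U ⊆ ℝ^{n+1} be open, and let u : U → ℝ^{n+1}, ε : U → ℝ, p : U → ℝ be smooth with Σ_{μ,ν} g_{μν} u^μ(x) u^ν(x) = −c² for all x ∈ U. Define T^{μν} := p g^{μν} + c^{-2}(ε + p) u^μ u^ν and P^{νμ} := g^{νμ} + c^{-2} u^ν u^μ. Then Σ_μ ∂_μ T^{μν} = 0 on U for every ν ∈ {0,…,n} if and only if both of the following hold on U: (a) Σ_μ ∂_μ(ε u^μ) + p Σ_μ ∂_μ u^μ = 0 (the energy equation), and (b) c^{-2}(ε + p) Σ_μ u^μ ∂_μ u^ν = − Σ_μ P^{νμ} ∂_μ p for every ν (the relativistic Euler equation). -/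

import Mathlib

noncomputable section

/-- The partial derivative `∂_μ f` of a function on `ℝ^{n+1}` in the `μ`-th coordinate
direction. -/
def pder {N : ℕ} (f : (Fin N → ℝ) → ℝ) (μ : Fin N) (x : Fin N → ℝ) : ℝ :=
  fderiv ℝ f x (Pi.single μ 1)

section PartialDerivative

variable {N : ℕ} {f h : (Fin N → ℝ) → ℝ} {x : Fin N → ℝ}

lemma pder_add (hf : DifferentiableAt ℝ f x) (hh : DifferentiableAt ℝ h x) (μ : Fin N) :
    pder (fun z => f z + h z) μ x = pder f μ x + pder h μ x := by
  simp [pder, fderiv_fun_add hf hh]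

lemma pder_mul (hf : DifferentiableAt ℝ f x) (hh : DifferentiableAt ℝ h x) (μ : Fin N) :
    pder (fun z => f z * h z) μ x = pder f μ x * h x + f x * pder h μ x := by
  simp [pder, fderiv_fun_mul hf hh]
  ring

lemma pder_const (a : ℝ) (μ : Fin N) : pder (fun _ => a) μ x = 0 := by
  simp [pder]

lemma pder_sum {ι : Type*} (s : Finset ι) {F : ι → (Fin N → ℝ) → ℝ}
    (hF : ∀ i ∈ s, DifferentiableAt ℝ (F i) x) (μ : Fin N) :
    pder (fun z => ∑ i ∈ s, F i z) μ x = ∑ i ∈ s, pder (F i) μ x := by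
  simp [pder, fderiv_fun_sum hF]

end PartialDerivative

/-- If `g(u, u)` is locally constant, then every partial derivative of `u` is `g`-orthogonal
to `u`. -/
lemma sum_metric_mul_pder_eq_zero {N : ℕ} {g : Fin N → Fin N → ℝ}
    (hg : ∀ μ ν, g μ ν = g ν μ) {u : (Fin N → ℝ) → Fin N → ℝ} {x : Fin N → ℝ} {a : ℝ}
    (hu : ∀ μ, DifferentiableAt ℝ (fun z => u z μ) x)
    (hnorm : (fun z => ∑ μ, ∑ ν, g μ ν * u z μ * u z ν) =ᶠ[nhds x] fun _ => a) (κ : Fin N) :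
    ∑ ν, (∑ μ, g μ ν * u x μ) * pder (fun z => u z ν) κ x = 0 := by
  have hzero : pder (fun z => ∑ μ, ∑ ν, g μ ν * u z μ * u z ν) κ x = 0 := by
    rw [pder, hnorm.fderiv_eq]
    exact pder_const a κ
  have hgu : ∀ μ ν, DifferentiableAt ℝ (fun z => g μ ν * u z μ) x :=
    fun μ ν => (hu μ).const_mul _
  have hterm : ∀ μ ν, pder (fun z => g μ ν * u z μ * u z ν) κ x
      = g ν μ * u x ν * pder (fun z => u z μ) κ x
        + g μ ν * u x μ * pder (fun z => u z ν) κ x := by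
    intro μ ν
    rw [pder_mul (hgu μ ν) (hu ν), pder_mul (differentiableAt_const _) (hu μ), pder_const,
      hg ν μ]
    ring
  rw [pder_sum _ fun μ _ => DifferentiableAt.fun_sum fun ν _ => (hgu μ ν).fun_mul (hu ν)] at hzero
  simp_rw [pder_sum _ fun ν _ => (hgu _ ν).fun_mul (hu ν), hterm, Finset.sum_add_distrib] at hzero
  rw [Finset.sum_comm (f := fun μ ν => g μ ν * u x μ * pder (fun z => u z ν) κ x)] at hzero
  simp_rw [Finset.sum_mul]
  linarith

/-- The divergence of the perfect fluid tensor is the sum of the Euler residual and the energy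
residual times `c⁻² u`. -/
lemma sum_pder_perfectFluid {N : ℕ} {h : Fin N → Fin N → ℝ}
    (hh : ∀ μ ν, h μ ν = h ν μ) (k : ℝ) {u : (Fin N → ℝ) → Fin N → ℝ}
    {ε p : (Fin N → ℝ) → ℝ} {x : Fin N → ℝ}
    (hu : ∀ μ, DifferentiableAt ℝ (fun z => u z μ) x)
    (hε : DifferentiableAt ℝ ε x) (hp : DifferentiableAt ℝ p x) (ν : Fin N) :
    ∑ μ, pder (fun z => p z * h μ ν + k * (ε z + p z) * u z μ * u z ν) μ x
      = (k * (ε x + p x) * (∑ μ, u x μ * pder (fun z => u z ν) μ x)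
          + ∑ μ, (h ν μ + k * u x ν * u x μ) * pder p μ x)
        + k * u x ν * ((∑ μ, pder (fun z => ε z * u z μ) μ x)
          + p x * ∑ μ, pder (fun z => u z μ) μ x) := by
  have hk : DifferentiableAt ℝ (fun z => k * (ε z + p z)) x := (hε.fun_add hp).const_mul k
  simp_rw [Finset.mul_sum, mul_add, Finset.mul_sum, ← Finset.sum_add_distrib]
  refine Finset.sum_congr rfl fun μ _ => ?_
  simp_rw [← mul_add]
  rw [pder_add (hp.mul_const _) ((hk.fun_mul (hu μ)).fun_mul (hu ν)),
    pder_mul hp (differentiableAt_const _), pder_const, pder_mul (hk.fun_mul (hu μ)) (hu ν),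
    pder_mul hk (hu μ), pder_mul (differentiableAt_const _) (hε.fun_add hp), pder_const,
    pder_add hε hp, pder_mul hε (hu μ), hh μ ν]
  ring

/-- A vector `F + k e u` with `l(F) = 0` and `l(u) k = -1` vanishes iff `F` and `e` do. -/
lemma forall_add_mul_eq_zero_iff {ι : Type*} [Fintype ι] {l u F : ι → ℝ} {k e : ℝ}
    (hF : ∑ ν, l ν * F ν = 0) (hu : (∑ ν, l ν * u ν) * k = -1) :
    (∀ ν, F ν + k * u ν * e = 0) ↔ e = 0 ∧ ∀ ν, F ν = 0 := by
  refine ⟨fun H => ?_, fun ⟨he, H⟩ ν => by simp [he, H ν]⟩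
  have he : e = 0 := by
    have hsum : ∑ ν, l ν * (F ν + k * u ν * e)
        = ∑ ν, l ν * F ν + (∑ ν, l ν * u ν) * k * e := by
      simp_rw [Finset.sum_mul, ← Finset.sum_add_distrib]
      exact Finset.sum_congr rfl fun ν _ => by ring
    simp only [H, mul_zero, Finset.sum_const_zero, hF, hu] at hsum
    linarith
  exact ⟨he, fun ν => by simpa [he] using H ν⟩

/-- The Euler residual is annihilated by the covector `l` dual to `u`. -/
lemma sum_mul_eulerResidual_eq_zero {ι : Type*} [Fintype ι] {h A : ι → ι → ℝ}
    {l u q : ι → ℝ} {k w : ℝ} (hlh : ∀ μ, ∑ ν, l ν * h ν μ = u μ)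
    (hlu : (∑ ν, l ν * u ν) * k = -1) (hlA : ∀ μ, ∑ ν, l ν * A ν μ = 0) :
    ∑ ν, l ν * (w * (∑ μ, u μ * A ν μ) + ∑ μ, (h ν μ + k * u ν * u μ) * q μ) = 0 := by
  calc _ = ∑ μ, (w * u μ * (∑ ν, l ν * A ν μ)
          + ((∑ ν, l ν * h ν μ) + (∑ ν, l ν * u ν) * k * u μ) * q μ) := by
        simp_rw [Finset.mul_sum, Finset.sum_mul, ← Finset.sum_add_distrib, Finset.sum_mul,
          ← Finset.sum_add_distrib, Finset.mul_sum]
        rw [Finset.sum_comm]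
        exact Finset.sum_congr rfl fun μ _ => Finset.sum_congr rfl fun ν _ => by ring
    _ = 0 := by simp [hlh, hlu, hlA]

/-- For a relativistic perfect fluid with stress-energy-momentum
tensor `T^{μν} = p g^{μν} + c⁻²(ε + p) u^μ u^ν` in coordinates where the Lorentzian
metric `g` is constant, the conservation law `∂_μ T^{μν} = 0` is equivalent to the
energy equation together with the relativistic Euler equation. -/
theorem perfect_fluid_conservation_equivalence
    (n : ℕ) (hn : 1 ≤ n) (c : ℝ) (hc : 0 < c)
    (g : Fin (n + 1) → Fin (n + 1) → ℝ) (hgsym : ∀ μ ν, g μ ν = g ν μ)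
    (hgdet : IsUnit (Matrix.of g).det)
    (U : Set (Fin (n + 1) → ℝ)) (hU : IsOpen U)
    (u : (Fin (n + 1) → ℝ) → Fin (n + 1) → ℝ)
    (ε prs : (Fin (n + 1) → ℝ) → ℝ)
    (hu : ∀ μ, ContDiffOn ℝ (⊤ : ℕ∞) (fun x => u x μ) U)
    (hε : ContDiffOn ℝ (⊤ : ℕ∞) ε U) (hprs : ContDiffOn ℝ (⊤ : ℕ∞) prs U)
    (hnorm : ∀ x ∈ U, (∑ μ, ∑ ν, g μ ν * u x μ * u x ν) = -c ^ 2) :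
    (∀ x ∈ U, ∀ ν : Fin (n + 1),
        (∑ μ, pder (fun z => prs z * (Matrix.of g)⁻¹ μ ν
          + (c ^ 2)⁻¹ * (ε z + prs z) * u z μ * u z ν) μ x) = 0)
    ↔ ((∀ x ∈ U,
          (∑ μ, pder (fun z => ε z * u z μ) μ x)
            + prs x * ∑ μ, pder (fun z => u z μ) μ x = 0)
        ∧ (∀ x ∈ U, ∀ ν : Fin (n + 1),
          (c ^ 2)⁻¹ * (ε x + prs x) * (∑ μ, u x μ * pder (fun z => u z ν) μ x)
            = -∑ μ, ((Matrix.of g)⁻¹ ν μ + (c ^ 2)⁻¹ * u x ν * u x μ)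
                * pder prs μ x)) := by
  have hinv : ∀ μ ν, (Matrix.of g)⁻¹ μ ν = (Matrix.of g)⁻¹ ν μ := by
    have hsymm : (Matrix.of g).IsSymm := Matrix.IsSymm.ext fun μ ν => hgsym ν μ
    exact fun μ ν => hsymm.inv.apply ν μ
  rw [← forall₂_and]
  refine forall₂_congr fun x hx => ?_
  have hxU : U ∈ nhds x := hU.mem_nhds hx
  have du : ∀ μ, DifferentiableAt ℝ (fun z => u z μ) x :=
    fun μ => ((hu μ).contDiffAt hxU).differentiableAt (by simp)
  have dε : DifferentiableAt ℝ ε x := (hε.contDiffAt hxU).differentiableAt (by simp)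
  have dp : DifferentiableAt ℝ prs x := (hprs.contDiffAt hxU).differentiableAt (by simp)
  have hlA := sum_metric_mul_pder_eq_zero hgsym du
    (Filter.mem_of_superset hxU fun z hz => hnorm z hz)
  have hlu : (∑ ν, (∑ μ, g μ ν * u x μ) * u x ν) * (c ^ 2)⁻¹ = -1 := by
    simp_rw [Finset.sum_mul _ (fun μ => g μ _ * u x μ)]
    rw [Finset.sum_comm, hnorm x hx]
    field_simp
  have hlh : ∀ κ, ∑ ν, (∑ μ, g μ ν * u x μ) * (Matrix.of g)⁻¹ ν κ = u x κ := by
    intro κ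
    have hvec : Matrix.vecMul (Matrix.vecMul (u x) (Matrix.of g)) (Matrix.of g)⁻¹ = u x := by
      rw [Matrix.vecMul_vecMul, Matrix.mul_nonsing_inv _ hgdet, Matrix.vecMul_one]
    simpa [Matrix.vecMul, dotProduct, mul_comm] using congrFun hvec κ
  simp_rw [sum_pder_perfectFluid hinv (c ^ 2)⁻¹ du dε dp, eq_neg_iff_add_eq_zero]
  exact forall_add_mul_eq_zero_iff (sum_mul_eulerResidual_eq_zero hlh hlu hlA) hlu
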